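/- Let U ⊆ ℝ² be an open connected set, f = (f₁, f₂) : U → ℝ² a C² map with det Df(z) ≠ 0 for every z ∈ U, and z₀ ∈ U a point with f(z₀) = (0,0). If every point z ∈ U \ {z₀} lies on a periodic solution of ∇H_f^⊥ whose image is contained in U (i.e., the center z₀ is global), then f is injective on U. -/

import Mathlib

open Real Set

/-- Partial derivative in the `x` direction. -/
noncomputable def pdx (g : ℝ × ℝ → ℝ) (z : ℝ × ℝ) : ℝ := fderiv ℝ g z (1, 0)

/-- Partial derivative in the `y` direction. -/
noncomputable def pdy (g : ℝ × ℝ → ℝ) (z : ℝ × ℝ) : ℝ := fderiv ℝ g z (0, 1)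

/-- The Hamiltonian `H_f = (f₁² + f₂²)/2`. -/
noncomputable def Ham (f : ℝ × ℝ → ℝ × ℝ) (z : ℝ × ℝ) : ℝ :=
  ((f z).1 ^ 2 + (f z).2 ^ 2) / 2

/-- The Hamiltonian vector field `∇H_f^⊥ = (−∂H_f/∂y, ∂H_f/∂x)`. -/
noncomputable def hamVF (f : ℝ × ℝ → ℝ × ℝ) (z : ℝ × ℝ) : ℝ × ℝ :=
  (-(pdy (Ham f) z), pdx (Ham f) z)

/-- The Jacobian determinant `det Df = ∂f₁/∂x ∂f₂/∂y − ∂f₂/∂x ∂f₁/∂y`. -/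
noncomputable def jacDet (f : ℝ × ℝ → ℝ × ℝ) (z : ℝ × ℝ) : ℝ :=
  pdx (fun w => (f w).1) z * pdy (fun w => (f w).2) z -
    pdx (fun w => (f w).2) z * pdy (fun w => (f w).1) z

/-- `γ` is a periodic solution of the vector field `X` whose image is contained in `S`:
a non-constant `C¹` curve solving `γ' = X ∘ γ` with some period `T > 0`. -/
def IsPeriodicSolOn (X : ℝ × ℝ → ℝ × ℝ) (S : Set (ℝ × ℝ)) (γ : ℝ → ℝ × ℝ) : Prop :=
  (∀ t, γ t ∈ S) ∧ (∀ t, HasDerivAt γ (X (γ t)) t) ∧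
    (∃ T > 0, ∀ t, γ (t + T) = γ t) ∧ ∃ t s, γ t ≠ γ s

/-- The Euclidean norm on `ℝ²`. -/
noncomputable def euclNorm (w : ℝ × ℝ) : ℝ := Real.sqrt (w.1 ^ 2 + w.2 ^ 2)

/-- The open Euclidean disc of radius `r` centered at the origin. -/
def disc (r : ℝ) : Set (ℝ × ℝ) := {w | euclNorm w < r}

/-- `W` is the period annulus of the singular point `z₀` of the vector field `X` on `U`:
the maximal open connected subset of `U` containing `z₀` all whose points other than `z₀`
lie on periodic solutions of `X` contained in `W`. -/
def IsPeriodAnnulus (X : ℝ × ℝ → ℝ × ℝ) (U : Set (ℝ × ℝ)) (z₀ : ℝ × ℝ)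
    (W : Set (ℝ × ℝ)) : Prop :=
  z₀ ∈ W ∧ W ⊆ U ∧ IsOpen W ∧ IsConnected W ∧
    (∀ z ∈ W \ {z₀}, ∃ γ, IsPeriodicSolOn X W γ ∧ γ 0 = z) ∧
    ∀ W', z₀ ∈ W' → W' ⊆ U → IsOpen W' → IsConnected W' →
      (∀ z ∈ W' \ {z₀}, ∃ γ, IsPeriodicSolOn X W' γ ∧ γ 0 = z) → W ⊆ W' → W' = W

section Topological

open Metric Filter Topology

variable {E V : Type*} [TopologicalSpace E] [NormedAddCommGroup V] [NormedSpace ℝ V]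
  {F : E → V}

/-- A section of a local homeomorphism over a closed ball extends to a larger open ball. -/
lemma IsLocalHomeomorph.exists_section_ball [ProperSpace V] (hF : IsLocalHomeomorph F) {R : ℝ}
    (hR : 0 ≤ R) {g : V → E} (hg : ContinuousOn g (closedBall 0 R))
    (hFg : ∀ v ∈ closedBall (0 : V) R, F (g v) = v) :
    ∃ R' > R, ∃ g' : V → E, ContinuousOn g' (ball 0 R') ∧
      (∀ v ∈ ball (0 : V) R', F (g' v) = v) ∧ g' 0 = g 0 := by
  have hK : IsCompact (closedBall (0 : V) R) := isCompact_closedBall 0 R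
  have hinj : InjOn F (g '' closedBall 0 R) := by
    rintro _ ⟨v, hv, rfl⟩ _ ⟨w, hw, rfl⟩ h
    rw [hFg v hv, hFg w hw] at h
    rw [h]
  obtain ⟨t, ht, htinj⟩ := hinj.exists_mem_nhdsSet (hK.image_of_continuousOn hg)
    (fun x _ => hF.continuous.continuousAt)
    (fun x _ => isLocallyInjective_iff_nhds.1 hF.isLocallyInjective x)
  obtain ⟨N, hNo, hKN, hNt⟩ := mem_nhdsSet_iff_exists.1 ht
  have hNinj : InjOn F N := htinj.mono hNt
  have hsub : closedBall (0 : V) R ⊆ F '' N := fun v hv =>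
    ⟨g v, hKN (mem_image_of_mem g hv), hFg v hv⟩
  obtain ⟨δ, hδ, hδN⟩ := hK.exists_thickening_subset_open (hF.isOpenMap N hNo) hsub
  rw [thickening_closedBall hδ hR] at hδN
  have h0 : (0 : V) ∈ closedBall 0 R := mem_closedBall_self hR
  have : Nonempty E := ⟨g 0⟩
  refine ⟨δ + R, by linarith, Function.invFunOn F N, ?_, ?_, ?_⟩
  · intro v hv
    obtain ⟨x, hx, rfl⟩ := hδN hv
    refine ContinuousAt.continuousWithinAt ?_
    rw [ContinuousAt, hNinj.leftInvOn_invFunOn hx, ← hF.map_nhds_eq x, tendsto_map'_iff]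
    refine tendsto_id.congr' ?_
    filter_upwards [hNo.mem_nhds hx] with y hy
    exact (hNinj.leftInvOn_invFunOn hy).symm
  · intro v hv
    exact Function.invFunOn_eq (hδN hv)
  · conv_lhs => rw [← hFg 0 h0]
    exact hNinj.leftInvOn_invFunOn (hKN (mem_image_of_mem g h0))

/-- At a limit point of a section over an open convex set, the section agrees with a local
inverse. -/
lemma IsLocalHomeomorph.exists_local_section [T2Space E] (hF : IsLocalHomeomorph F) {S : Set V}
    (hS : Convex ℝ S) {g : V → E} (hg : ContinuousOn g S) (hFg : ∀ v ∈ S, F (g v) = v)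
    {z : E} (hz : z ∈ closure (g '' S)) :
    ∃ ε > 0, ∃ h : V → E, ContinuousOn h (ball (F z) ε) ∧ h (F z) = z ∧
      EqOn g h (S ∩ ball (F z) ε) ∧ ∀ᶠ y in 𝓝 z, h (F y) = y := by
  set φ := hF.localInverseAt (x := z) with hφ
  have hev : ∀ᶠ y in 𝓝 z, φ (F y) = y := by
    filter_upwards [φ.open_target.mem_nhds hF.self_mem_localInverseAt_target] with y hy
    have := φ.right_inv hy
    rwa [hφ, hF.localInverseAt_symm] at this
  obtain ⟨ε, hε, hball⟩ := Metric.isOpen_iff.1 φ.open_source _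
    hF.apply_self_mem_localInverseAt_source
  refine ⟨ε, hε, φ, φ.continuousOn.mono hball, hF.localInverseAt_apply_self, ?_, hev⟩
  have hB : ∀ᶠ y in 𝓝 z, F y ∈ ball (F z) ε :=
    hF.continuous.continuousAt.eventually (ball_mem_nhds _ hε)
  obtain ⟨_, ⟨hy1, hy2⟩, w, hw, rfl⟩ := mem_closure_iff_nhds.1 hz _ (hev.and hB)
  rw [hFg w hw] at hy1 hy2
  refine (T2Space.isSeparatedMap F).eqOn_of_comp_eqOn hF.isLocallyInjective
    (hS.inter (convex_ball _ _)).isPreconnected (hg.mono inter_subset_left)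
    (φ.continuousOn.mono (inter_subset_right.trans hball)) ?_ ⟨hw, hy2⟩ hy1.symm
  intro v hv
  simp only [Function.comp]
  rw [hFg v hv.1, hF.apply_localInverseAt_of_mem (hball hv.2)]

lemma IsLocalHomeomorph.section_apply_of_mem_closure [T2Space E] (hF : IsLocalHomeomorph F) {S : Set V}
    (hS : Convex ℝ S) {g : V → E} (hg : ContinuousOn g S) (hFg : ∀ v ∈ S, F (g v) = v)
    {z : E} (hz : z ∈ closure (g '' S)) (hzS : F z ∈ S) : g (F z) = z := by
  obtain ⟨ε, hε, h, -, hhz, heq, -⟩ := hF.exists_local_section hS hg hFg hz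
  rw [heq ⟨hzS, mem_ball_self hε⟩, hhz]

lemma IsLocalHomeomorph.tendsto_section_of_mem_closure [T2Space E] (hF : IsLocalHomeomorph F) {S : Set V}
    (hS : Convex ℝ S) {g : V → E} (hg : ContinuousOn g S) (hFg : ∀ v ∈ S, F (g v) = v)
    {z : E} (hz : z ∈ closure (g '' S)) : Tendsto g (𝓝[S] (F z)) (𝓝 z) := by
  obtain ⟨ε, hε, h, hc, hhz, heq, -⟩ := hF.exists_local_section hS hg hFg hz
  have h1 : Tendsto h (𝓝[S] (F z)) (𝓝 z) := by
    have := (hc.continuousAt (ball_mem_nhds _ hε)).tendsto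
    rw [hhz] at this
    exact this.mono_left nhdsWithin_le_nhds
  refine h1.congr' ?_
  filter_upwards [self_mem_nhdsWithin, nhdsWithin_le_nhds (ball_mem_nhds _ hε)] with v hv hv'
  exact (heq ⟨hv, hv'⟩).symm

lemma IsLocalHomeomorph.eventually_mem_closure_section [T2Space E] (hF : IsLocalHomeomorph F) {S : Set V}
    (hS : Convex ℝ S) {g : V → E} (hg : ContinuousOn g S) (hFg : ∀ v ∈ S, F (g v) = v)
    {z : E} (hz : z ∈ closure (g '' S)) :
    ∀ᶠ y in 𝓝 z, F y ∈ closure S → y ∈ closure (g '' S) := by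
  obtain ⟨ε, hε, h, hc, hhz, heq, hev⟩ := hF.exists_local_section hS hg hFg hz
  filter_upwards [hev, hF.continuous.continuousAt.eventually (ball_mem_nhds _ hε)] with y hy hyB hyS
  have h1 : F y ∈ closure (S ∩ ball (F z) ε) := by
    rw [inter_comm]
    exact isOpen_ball.inter_closure ⟨hyB, hyS⟩
  have h2 := (hc.continuousAt (isOpen_ball.mem_nhds hyB)).continuousWithinAt.mem_closure_image
    (s := S ∩ ball (F z) ε) h1
  rw [hy, ← heq.image_eq] at h2
  exact closure_mono (image_mono inter_subset_left) h2

/-- Let `F` be a local homeomorphism from a connected regular Hausdorff space with `F e₀ = 0`. If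
every point other than `e₀` lies on a preconnected set mapped by `F` onto a sphere centered at the
origin, then `F` is injective. -/
theorem IsLocalHomeomorph.injective_of_preconnected_spheres [ProperSpace V] [T3Space E]
    [PreconnectedSpace E]
    (hF : IsLocalHomeomorph F) {e₀ : E} (he₀ : F e₀ = 0)
    (hC : ∀ e ≠ e₀, ∃ C : Set E, IsPreconnected C ∧ e ∈ C ∧ F '' C = sphere 0 ‖F e‖) :
    Function.Injective F := by
  let P : ℝ → (V → E) → Prop := fun r g =>
    ContinuousOn g (ball 0 r) ∧ (∀ v ∈ ball (0 : V) r, F (g v) = v) ∧ g 0 = e₀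
  have huniq : ∀ {r s g h}, P r g → P s h → ∀ v : V, ‖v‖ < r → ‖v‖ < s → g v = h v := by
    intro r s g h hg hh v hvr hvs
    have key : EqOn g h (ball 0 (min r s)) := by
      have hr : ball (0 : V) (min r s) ⊆ ball 0 r := ball_subset_ball (min_le_left _ _)
      have hs : ball (0 : V) (min r s) ⊆ ball 0 s := ball_subset_ball (min_le_right _ _)
      refine (T2Space.isSeparatedMap F).eqOn_of_comp_eqOn hF.isLocallyInjective
        (convex_ball _ _).isPreconnected (hg.1.mono hr) (hh.1.mono hs) ?_ (a := 0) ?_ ?_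
      · intro w hw
        simp only [Function.comp]
        rw [hg.2.1 w (hr hw), hh.2.1 w (hs hw)]
      · exact mem_ball_self ((norm_nonneg v).trans_lt (lt_min hvr hvs))
      · rw [hg.2.2, hh.2.2]
    exact key (by simp [hvr, hvs])
  let S : Set V := {v | ∃ r g, P r g ∧ ‖v‖ < r}
  have hSmono : ∀ {v w : V}, ‖v‖ ≤ ‖w‖ → w ∈ S → v ∈ S := by
    rintro v w hvw ⟨r, g, hP, hr⟩
    exact ⟨r, g, hP, hvw.trans_lt hr⟩
  have : Nonempty E := ⟨e₀⟩
  have hch : ∀ v : V, ∃ e, v ∈ S → ∃ r g, P r g ∧ ‖v‖ < r ∧ e = g v := by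
    intro v
    by_cases hv : v ∈ S
    · obtain ⟨r, g, hP, hr⟩ := hv
      exact ⟨g v, fun _ => ⟨r, g, hP, hr, rfl⟩⟩
    · exact ⟨e₀, fun h => absurd h hv⟩
  choose G hG using hch
  have hGeq : ∀ {r g}, P r g → ∀ v : V, ‖v‖ < r → G v = g v := by
    intro r g hP v hv
    obtain ⟨r', g', hP', hr', he⟩ := hG v ⟨r, g, hP, hv⟩
    rw [he, huniq hP' hP v hr' hv]
  have hball : ∀ {r g}, P r g → ball (0 : V) r ⊆ S := by
    intro r g hP v hv
    exact ⟨r, g, hP, by simpa using hv⟩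
  have hGc : ContinuousOn G S := by
    rintro v ⟨r, g, hP, hr⟩
    have hn : ball (0 : V) r ∈ 𝓝 v := isOpen_ball.mem_nhds (by simpa using hr)
    refine ((hP.1.continuousAt hn).congr ?_).continuousWithinAt
    filter_upwards [hn] with w hw
    exact (hGeq hP w (by simpa using hw)).symm
  have hSo : IsOpen S := by
    rw [Metric.isOpen_iff]
    rintro v ⟨r, g, hP, hr⟩
    obtain ⟨ε, hε, h⟩ := Metric.isOpen_iff.1 (isOpen_ball (x := (0 : V)) (ε := r)) v
      (by simpa using hr)
    exact ⟨ε, hε, h.trans (hball hP)⟩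
  have hFG : ∀ v ∈ S, F (G v) = v := by
    rintro v ⟨r, g, hP, hr⟩
    rw [hGeq hP v hr]
    exact hP.2.1 v (by simpa using hr)
  have hSconv : Convex ℝ S := by
    intro v hv w hw a b ha hb hab
    have h1 : a • v + b • w ∈ closedBall (0 : V) (max ‖v‖ ‖w‖) :=
      convex_closedBall (0 : V) _ (by simp) (by simp) ha hb hab
    rw [mem_closedBall_zero_iff, le_max_iff] at h1
    exact h1.elim (fun h => hSmono h hv) (fun h => hSmono h hw)
  have hext : ∀ {R : ℝ} {g : V → E}, 0 ≤ R → ContinuousOn g (closedBall 0 R) →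
      (∀ v ∈ closedBall (0 : V) R, F (g v) = v) → g 0 = e₀ → closedBall (0 : V) R ⊆ S := by
    intro R g hR hg hFg hg0 v hv
    obtain ⟨R', hR', g', h1, h2, h3⟩ := hF.exists_section_ball hR hg hFg
    exact ⟨R', g', ⟨h1, h2, h3.trans hg0⟩, (mem_closedBall_zero_iff.1 hv).trans_lt hR'⟩
  have h0S : (0 : V) ∈ S := by
    refine hext (R := 0) (g := fun _ => e₀) le_rfl continuousOn_const ?_ rfl
      (mem_closedBall_self le_rfl)
    intro v hv
    rw [closedBall_zero, mem_singleton_iff] at hv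
    rw [hv, he₀]
  have hG0 : G 0 = e₀ := by
    obtain ⟨r, g, hP, hr, he⟩ := hG 0 h0S
    rw [he, hP.2.2]
  have hmemS : ∀ z ∈ closure (G '' S), F z ∈ S := by
    intro z hz
    by_contra hzS
    have hne : z ≠ e₀ := by
      rintro rfl
      exact hzS (he₀ ▸ h0S)
    obtain ⟨C, hCc, hzC, hFC⟩ := hC z hne
    have hFz : F z ∈ closure S := by
      refine closure_mono ?_ (hF.continuous.continuousAt.continuousWithinAt.mem_closure_image hz)
      rintro _ ⟨_, ⟨v, hv, rfl⟩, rfl⟩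
      rwa [hFG v hv]
    have hpos : 0 < ‖F z‖ := by
      rw [norm_pos_iff]
      intro h
      exact hzS (h ▸ h0S)
    have hSball : S = ball 0 ‖F z‖ := by
      ext v
      rw [mem_ball_zero_iff]
      constructor
      · intro hv
        by_contra hlt
        exact hzS (hSmono (not_lt.1 hlt) hv)
      · intro hv
        obtain ⟨w, hw1, hw2⟩ := mem_closure_iff.1 hFz {w | ‖v‖ < ‖w‖}
          (isOpen_lt continuous_const continuous_norm) hv
        exact hSmono (le_of_lt hw1) hw2
    have hclS : closure S = closedBall 0 ‖F z‖ := by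
      rw [hSball, closure_ball _ hpos.ne']
    have hCsub : C ⊆ closure (G '' S) := by
      have hop : IsOpen {y | ∀ᶠ x in 𝓝 y, F x ∈ closure S → x ∈ closure (G '' S)} :=
        isOpen_setOfPred_eventually_nhds
      have hmem : ∀ x ∈ C, (∀ᶠ x' in 𝓝 x, F x' ∈ closure S → x' ∈ closure (G '' S)) →
          x ∈ closure (G '' S) := by
        intro x hxC hx
        have hFx : F x ∈ sphere (0 : V) ‖F z‖ := hFC ▸ mem_image_of_mem F hxC
        exact hx.self_of_nhds (hclS ▸ sphere_subset_closedBall hFx)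
      intro y hy
      by_contra hyA
      obtain ⟨x, hxC, hx1, hx2⟩ := hCc _ _ hop isClosed_closure.isOpen_compl
        (fun x _ => (em (x ∈ closure (G '' S))).imp
          (fun h => hF.eventually_mem_closure_section hSconv hGc hFG h) id)
        ⟨z, hzC, hF.eventually_mem_closure_section hSconv hGc hFG hz⟩ ⟨y, hy, hyA⟩
      exact hx2 (hmem x hxC hx1)
    have hlim : ∀ v ∈ closedBall (0 : V) ‖F z‖, ∃ y, F y = v ∧ Tendsto G (𝓝[S] v) (𝓝 y) := by
      intro v hv
      rcases (mem_closedBall_zero_iff.1 hv).lt_or_eq with h | h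
      · have hvS : v ∈ S := by rw [hSball]; simpa using h
        exact ⟨G v, hFG v hvS, hGc v hvS⟩
      · have : v ∈ F '' C := by rw [hFC]; simpa using h
        obtain ⟨y, hy, rfl⟩ := this
        exact ⟨y, rfl, hF.tendsto_section_of_mem_closure hSconv hGc hFG (hCsub hy)⟩
    refine hzS (hext (g := extendFrom S G) (norm_nonneg (F z)) ?_ ?_ ?_ (by simp))
    · exact continuousOn_extendFrom hclS.ge
        fun v hv => (hlim v hv).imp fun y hy => hy.2
    · intro v hv
      obtain ⟨y, hy, hty⟩ := hlim v hv
      rw [extendFrom_eq (hclS.ge hv) hty, hy]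
    · rw [extendFrom_eq (subset_closure h0S) (hGc 0 h0S), hG0]
  have hAcl : IsClosed (G '' S) := by
    rw [← closure_subset_iff_isClosed]
    intro z hz
    exact ⟨F z, hmemS z hz, hF.section_apply_of_mem_closure hSconv hGc hFG hz (hmemS z hz)⟩
  have hAo : IsOpen (G '' S) := by
    rw [isOpen_iff_mem_nhds]
    rintro _ ⟨v, hv, rfl⟩
    obtain ⟨ε, hε, h, -, -, heq, hev⟩ := hF.exists_local_section hSconv hGc hFG
      (subset_closure (mem_image_of_mem G hv))
    filter_upwards [hev, hF.continuous.continuousAt.eventually (ball_mem_nhds _ hε),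
      hF.continuous.continuousAt.eventually (hSo.mem_nhds ((hFG v hv).symm ▸ hv))] with y h1 h2 h3
    exact ⟨F y, h3, (heq ⟨h3, h2⟩).trans h1⟩
  have huniv : G '' S = univ := IsClopen.eq_univ ⟨hAcl, hAo⟩ ⟨e₀, 0, h0S, hG0⟩
  have hinv : ∀ z, G (F z) = z := by
    intro z
    obtain ⟨v, hv, rfl⟩ := huniv.symm ▸ mem_univ z
    rw [hFG v hv]
  exact Function.LeftInverse.injective hinv

end Topological

section Rotation

lemma surjective_intervalIntegral_of_periodic_pos {d : ℝ → ℝ} {T : ℝ} (hT : 0 < T)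
    (hd : Continuous d) (hper : Function.Periodic d T) (hpos : ∀ t, 0 < d t) :
    Function.Surjective fun t => ∫ s in (0 : ℝ)..t, d s := by
  have hdi : ∀ a b, IntervalIntegrable d MeasureTheory.volume a b :=
    fun a b => hd.intervalIntegrable a b
  exact (intervalIntegral.continuous_primitive hdi 0).surjective
    (hper.tendsto_atTop_intervalIntegral_of_pos' (hdi 0 T) hpos hT)
    (hper.tendsto_atBot_intervalIntegral_of_pos' (hdi 0 T) hpos hT)

lemma surjective_intervalIntegral_of_periodic_ne_zero {d : ℝ → ℝ} {T : ℝ} (hT : 0 < T)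
    (hd : Continuous d) (hper : Function.Periodic d T) (hne : ∀ t, d t ≠ 0) :
    Function.Surjective fun t => ∫ s in (0 : ℝ)..t, d s := by
  have hsign : (∀ t, 0 < d t) ∨ ∀ t, d t < 0 := by
    by_contra! h
    obtain ⟨⟨a, ha⟩, b, hb⟩ := h
    obtain ⟨t, ht⟩ := mem_range_of_exists_le_of_exists_ge hd ⟨a, ha⟩ ⟨b, hb⟩
    exact hne t ht
  rcases hsign with h | h
  · exact surjective_intervalIntegral_of_periodic_pos hT hd hper h
  · intro y
    obtain ⟨t, ht⟩ := surjective_intervalIntegral_of_periodic_pos hT hd.neg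
      (fun t => congrArg Neg.neg (hper t)) (fun t => neg_pos.2 (h t)) (-y)
    refine ⟨t, ?_⟩
    simpa using ht

/-- A curve in the plane rotating about the origin with periodic nonvanishing angular velocity
covers a circle. -/
lemma range_eq_sphere_of_hasDerivAt_rotation {u : ℝ → ℂ} {d : ℝ → ℝ} {T : ℝ} (hT : 0 < T)
    (hd : Continuous d) (hper : Function.Periodic d T) (hne : ∀ t, d t ≠ 0)
    (hu : ∀ t, HasDerivAt u (d t * Complex.I * u t) t) :
    range u = Metric.sphere 0 ‖u 0‖ := by
  set θ : ℝ → ℝ := fun t => ∫ s in (0 : ℝ)..t, d s with hθ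
  have hθ' : ∀ t, HasDerivAt θ (d t) t := fun t => hd.integral_hasStrictDerivAt 0 t |>.hasDerivAt
  have hE : ∀ t, HasDerivAt (fun t => Complex.exp (-(θ t * Complex.I)) * u t) 0 t := by
    intro t
    have h1 := (((hθ' t).ofReal_comp.mul_const Complex.I).neg.cexp).mul (hu t)
    refine h1.congr_deriv ?_
    ring
  have hconst : ∀ t, Complex.exp (-(θ t * Complex.I)) * u t = u 0 := by
    intro t
    have := is_const_of_deriv_eq_zero (fun s => (hE s).differentiableAt)
      (fun s => (hE s).deriv) t 0
    simpa [hθ] using this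
  have hform : ∀ t, u t = Complex.exp (θ t * Complex.I) * u 0 := by
    intro t
    rw [← hconst t, ← mul_assoc, ← Complex.exp_add, add_neg_cancel, Complex.exp_zero, one_mul]
  ext w
  rw [mem_sphere_zero_iff_norm]
  constructor
  · rintro ⟨t, rfl⟩
    rw [hform t, norm_mul, Complex.norm_exp_ofReal_mul_I, one_mul]
  · intro hw
    by_cases h0 : u 0 = 0
    · refine ⟨0, ?_⟩
      rw [h0, norm_zero, norm_eq_zero] at hw
      rw [h0, hw]
    · have h1 : ‖w / u 0‖ = 1 := by
        rw [norm_div, hw, div_self (norm_ne_zero_iff.2 h0)]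
      obtain ⟨φ, hφ⟩ := (Complex.norm_eq_one_iff _).1 h1
      obtain ⟨t, rfl⟩ := surjective_intervalIntegral_of_periodic_ne_zero hT hd hper hne φ
      refine ⟨t, ?_⟩
      rw [hform t, hφ, div_mul_cancel₀ _ h0]

end Rotation

section Hamiltonian

variable {f : ℝ × ℝ → ℝ × ℝ} {z : ℝ × ℝ}

lemma pdx_fst_comp (hf : DifferentiableAt ℝ f z) :
    pdx (fun w => (f w).1) z = (fderiv ℝ f z (1, 0)).1 := by
  rw [pdx, hf.hasFDerivAt.fst.fderiv]; rfl

lemma pdx_snd_comp (hf : DifferentiableAt ℝ f z) :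
    pdx (fun w => (f w).2) z = (fderiv ℝ f z (1, 0)).2 := by
  rw [pdx, hf.hasFDerivAt.snd.fderiv]; rfl

lemma pdy_fst_comp (hf : DifferentiableAt ℝ f z) :
    pdy (fun w => (f w).1) z = (fderiv ℝ f z (0, 1)).1 := by
  rw [pdy, hf.hasFDerivAt.fst.fderiv]; rfl

lemma pdy_snd_comp (hf : DifferentiableAt ℝ f z) :
    pdy (fun w => (f w).2) z = (fderiv ℝ f z (0, 1)).2 := by
  rw [pdy, hf.hasFDerivAt.snd.fderiv]; rfl

lemma jacDet_eq (hf : DifferentiableAt ℝ f z) :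
    jacDet f z = (fderiv ℝ f z (1, 0)).1 * (fderiv ℝ f z (0, 1)).2 -
      (fderiv ℝ f z (1, 0)).2 * (fderiv ℝ f z (0, 1)).1 := by
  rw [jacDet, pdx_fst_comp hf, pdx_snd_comp hf, pdy_fst_comp hf, pdy_snd_comp hf]

lemma fderiv_Ham_apply (hf : DifferentiableAt ℝ f z) (v : ℝ × ℝ) :
    fderiv ℝ (Ham f) z v =
      (f z).1 * (fderiv ℝ f z v).1 + (f z).2 * (fderiv ℝ f z v).2 := by
  have h := ((hf.hasFDerivAt.fst.pow 2).add (hf.hasFDerivAt.snd.pow 2)).mul_const (2⁻¹ : ℝ)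
  have h' : HasFDerivAt (Ham f) _ z := h.congr_of_eventuallyEq
    (Filter.Eventually.of_forall fun w => by simp [Ham, div_eq_mul_inv])
  rw [h'.fderiv]
  simp
  ring

lemma ContinuousLinearMap.apply_prod_eq (L : ℝ × ℝ →L[ℝ] ℝ × ℝ) (v : ℝ × ℝ) :
    L v = v.1 • L (1, 0) + v.2 • L (0, 1) := by
  rw [← map_smul, ← map_smul, ← map_add]
  simp

/-- The differential of `f` maps the Hamiltonian vector field to the rotational vector field
scaled by the Jacobian determinant. -/
lemma fderiv_hamVF (hf : DifferentiableAt ℝ f z) :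
    fderiv ℝ f z (hamVF f z) = (-(jacDet f z * (f z).2), jacDet f z * (f z).1) := by
  rw [ContinuousLinearMap.apply_prod_eq, jacDet_eq hf, hamVF, pdx, pdy, fderiv_Ham_apply hf,
    fderiv_Ham_apply hf]
  ext <;> simp <;> ring

lemma ContinuousOn.jacDet {U : Set (ℝ × ℝ)} (hU : IsOpen U) (hf : ContDiffOn ℝ 1 f U) :
    ContinuousOn (jacDet f) U := by
  have hc : ContinuousOn (fderiv ℝ f) U := hf.continuousOn_fderiv_of_isOpen hU le_rfl
  have h : ContinuousOn (fun z => (fderiv ℝ f z (1, 0)).1 * (fderiv ℝ f z (0, 1)).2 -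
      (fderiv ℝ f z (1, 0)).2 * (fderiv ℝ f z (0, 1)).1) U := by fun_prop
  exact h.congr fun z hz =>
    jacDet_eq ((hf.differentiableOn one_ne_zero).differentiableAt (hU.mem_nhds hz))

lemma isLocalHomeomorphOn_of_jacDet_ne_zero {U : Set (ℝ × ℝ)} (hU : IsOpen U)
    (hf : ContDiffOn ℝ 1 f U) (hdet : ∀ z ∈ U, jacDet f z ≠ 0) : IsLocalHomeomorphOn f U := by
  refine IsLocalHomeomorphOn.mk f U fun z hz => ?_
  have hfz : ContDiffAt ℝ 1 f z := hf.contDiffAt (hU.mem_nhds hz)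
  have hd := hdet z hz
  rw [jacDet_eq (hfz.differentiableAt one_ne_zero)] at hd
  have hinj : Function.Injective (fderiv ℝ f z).toLinearMap := by
    rw [← LinearMap.ker_eq_bot, LinearMap.ker_eq_bot']
    intro v hv
    have hv' : fderiv ℝ f z v = 0 := hv
    rw [ContinuousLinearMap.apply_prod_eq] at hv'
    have h1 := congrArg Prod.fst hv'
    have h2 := congrArg Prod.snd hv'
    simp only [Prod.fst_add, Prod.snd_add, Prod.smul_fst, Prod.smul_snd, smul_eq_mul,
      Prod.fst_zero, Prod.snd_zero] at h1 h2
    ext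
    · refine (mul_eq_zero.1 ?_).resolve_right hd
      linear_combination (fderiv ℝ f z (0, 1)).2 * h1 - (fderiv ℝ f z (0, 1)).1 * h2
    · refine (mul_eq_zero.1 ?_).resolve_right hd
      linear_combination (fderiv ℝ f z (1, 0)).1 * h2 - (fderiv ℝ f z (1, 0)).2 * h1
  let L : (ℝ × ℝ) ≃L[ℝ] ℝ × ℝ :=
    (LinearEquiv.ofInjectiveEndo (fderiv ℝ f z).toLinearMap hinj).toContinuousLinearEquiv
  have hL : (L : ℝ × ℝ →L[ℝ] ℝ × ℝ) = fderiv ℝ f z := by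
    ext <;> rfl
  have hs : HasStrictFDerivAt f (L : ℝ × ℝ →L[ℝ] ℝ × ℝ) z :=
    hL ▸ hfz.hasStrictFDerivAt one_ne_zero
  exact ⟨hs.toOpenPartialHomeomorph f, hs.mem_toOpenPartialHomeomorph_source, fun _ _ => rfl⟩

lemma hasDerivAt_comp_hamVF {γ : ℝ → ℝ × ℝ} {t : ℝ} (hf : DifferentiableAt ℝ f (γ t))
    (hγ : HasDerivAt γ (hamVF f (γ t)) t) :
    HasDerivAt (fun s => Complex.equivRealProdCLM.symm (f (γ s)))
      (jacDet f (γ t) * Complex.I * Complex.equivRealProdCLM.symm (f (γ t))) t := by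
  have h := hf.hasFDerivAt.comp_hasDerivAt t hγ
  rw [fderiv_hamVF hf] at h
  have h2 := Complex.equivRealProdCLM.symm.hasFDerivAt.comp_hasDerivAt t h
  refine h2.congr_deriv ?_
  apply Complex.ext <;> simp

end Hamiltonian

theorem global_center_implies_injective (U : Set (ℝ × ℝ)) (hUo : IsOpen U)
    (hUc : IsConnected U) (f : ℝ × ℝ → ℝ × ℝ) (hf : ContDiffOn ℝ 2 f U)
    (hdet : ∀ z ∈ U, jacDet f z ≠ 0)
    (z₀ : ℝ × ℝ) (hz₀ : z₀ ∈ U) (hfz : f z₀ = (0, 0))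
    (hglobal : ∀ z ∈ U \ {z₀}, ∃ γ, IsPeriodicSolOn (hamVF f) U γ ∧ γ 0 = z) :
    Set.InjOn f U := by
  have hf1 : ContDiffOn ℝ 1 f U := hf.of_le one_le_two
  have hdiff : ∀ z ∈ U, DifferentiableAt ℝ f z := fun z hz =>
    (hf1.differentiableOn one_ne_zero).differentiableAt (hUo.mem_nhds hz)
  let F : U → ℂ := fun z => Complex.equivRealProdCLM.symm (f z)
  have hF : IsLocalHomeomorph F := by
    have hfU : IsLocalHomeomorph (f ∘ ((↑) : U → ℝ × ℝ)) :=
      isLocalHomeomorph_iff_isLocalHomeomorphOn_univ.2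
        ((isLocalHomeomorphOn_of_jacDet_ne_zero hUo hf1 hdet).comp
          hUo.isOpenEmbedding_subtypeVal.isLocalHomeomorph.isLocalHomeomorphOn
          fun z _ => z.2)
    exact Complex.equivRealProdCLM.symm.toHomeomorph.isLocalHomeomorph.comp hfU
  have : PreconnectedSpace U := Subtype.preconnectedSpace hUc.isPreconnected
  have hFinj : Function.Injective F := by
    refine hF.injective_of_preconnected_spheres (e₀ := ⟨z₀, hz₀⟩) (by simp [F, hfz]) ?_
    rintro ⟨z, hz⟩ hne
    obtain ⟨γ, ⟨hγU, hγ, ⟨T, hT, hper⟩, -⟩, rfl⟩ := hglobal z ⟨hz, fun h => hne (Subtype.ext h)⟩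
    have hγc : Continuous γ := continuous_iff_continuousAt.2 fun t => (hγ t).continuousAt
    refine ⟨range fun t => (⟨γ t, hγU t⟩ : U), isPreconnected_range (hγc.subtype_mk hγU),
      ⟨0, rfl⟩, ?_⟩
    rw [← range_comp]
    exact range_eq_sphere_of_hasDerivAt_rotation hT
      ((ContinuousOn.jacDet hUo hf1).comp_continuous hγc hγU)
      (fun t => congrArg (jacDet f) (hper t)) (fun t => hdet _ (hγU t))
      (fun t => hasDerivAt_comp_hamVF (hdiff _ (hγU t)) (hγ t))
  intro a ha b hb hab
  have h : F ⟨a, ha⟩ = F ⟨b, hb⟩ := congrArg Complex.equivRealProdCLM.symm hab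
  exact congrArg Subtype.val (hFinj h)
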